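/- Let S be a finite thick generalized quadrangle. Assume that for each point p a nontrivial group E(p) of symmetries with center p is given, that there is a prime r dividing |E(p)| for every point p, and set G = ⟨E(p) : p a point⟩; assume moreover that E(p)^g = E(p^g) for every point p and every g ∈ G. Then for every point u, the group I(u^⊥) = ⟨E(w) : w ∈ u^⊥⟩ acts transitively on u^⊥ \ {u}, and I(u^⊥) is a normal subgroup of the stabilizer G_u of u in G. -/

import Mathlib

open Equiv

section GQDefs

variable {P L : Type*}

/-- A generalized quadrangle of order `(s,t)`: every line has `s+1` points, every point is
on `t+1` lines, two distinct points are on at most one common line, and for every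
non-incident point-line pair `(p, ℓ)` there is a unique pair `(q, M)` with `M` a line
through `p` and `q` a point incident with both `M` and `ℓ`. -/
structure IsGQ (I : P → L → Prop) (s t : ℕ) : Prop where
  point_count : ∀ ℓ : L, Nat.card {p : P // I p ℓ} = s + 1
  line_count : ∀ p : P, Nat.card {ℓ : L // I p ℓ} = t + 1
  unique_line : ∀ ⦃p q : P⦄, p ≠ q → ∀ ⦃ℓ m : L⦄, I p ℓ → I q ℓ → I p m → I q m → ℓ = m
  quad : ∀ ⦃p : P⦄ ⦃ℓ : L⦄, ¬ I p ℓ →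
    ∃! qM : P × L, I p qM.2 ∧ I qM.1 qM.2 ∧ I qM.1 ℓ

/-- Two points are collinear if some line is incident with both. -/
def Coll (I : P → L → Prop) (x y : P) : Prop := ∃ ℓ : L, I x ℓ ∧ I y ℓ

/-- The automorphism group of an incidence structure, as a subgroup of
`Perm P × Perm L`: pairs of permutations preserving incidence. -/
def autGroup (I : P → L → Prop) : Subgroup (Perm P × Perm L) where
  carrier := {g | ∀ p ℓ, I (g.1 p) (g.2 ℓ) ↔ I p ℓ}
  one_mem' := fun _ _ => Iff.rfl
  mul_mem' := fun {a b} ha hb p ℓ => (ha (b.1 p) (b.2 ℓ)).trans (hb p ℓ)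
  inv_mem' := by
    intro a ha p ℓ
    have h := ha (a⁻¹.1 p) (a⁻¹.2 ℓ)
    simpa using h.symm

/-- The full group `Ẽ(p)` of symmetries with center `p`: automorphisms fixing every
point collinear with `p`. -/
def symmGroup (I : P → L → Prop) (p : P) : Subgroup (Perm P × Perm L) where
  carrier := {g | g ∈ autGroup I ∧ ∀ y : P, Coll I p y → g.1 y = y}
  one_mem' := ⟨(autGroup I).one_mem, fun _ _ => rfl⟩
  mul_mem' := by
    rintro a b ⟨ha, ha'⟩ ⟨hb, hb'⟩
    refine ⟨(autGroup I).mul_mem ha hb, fun y hy => ?_⟩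
    have : (a * b).1 y = a.1 (b.1 y) := rfl
    rw [this, hb' y hy, ha' y hy]
  inv_mem' := by
    rintro a ⟨ha, ha'⟩
    refine ⟨(autGroup I).inv_mem ha, fun y hy => ?_⟩
    have h : a⁻¹.1 (a.1 y) = y := by simp
    rw [ha' y hy] at h
    exact h

/-- `x^⊥`: the set of points collinear with `x` (including `x` itself). -/
def perpSet (I : P → L → Prop) (x : P) : Set P := {y | Coll I x y}

/-- The hyperbolic line `{x,y}^{⊥⊥}`: points collinear with every point of
`{x,y}^⊥ = x^⊥ ∩ y^⊥`. -/
def hypLine (I : P → L → Prop) (x y : P) : Set P :=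
  {z | ∀ w ∈ perpSet I x ∩ perpSet I y, Coll I z w}

/-- The group `G` generated by all the point-symmetries of the quadrangle. -/
def bigGroup (I : P → L → Prop) : Subgroup (Perm P × Perm L) :=
  ⨆ x : P, symmGroup I x

/-- The set `P_r` of `r`-points: points whose full group of symmetries has order
divisible by `r`. -/
def Pr (I : P → L → Prop) (r : ℕ) : Set P :=
  {y | r ∣ Nat.card (symmGroup I y)}

/-- The set `L_r` of lines incident with at least two points of `P_r`. -/
def Lr (I : P → L → Prop) (r : ℕ) : Set L :=
  {ℓ | ∃ x y : P, x ≠ y ∧ x ∈ Pr I r ∧ y ∈ Pr I r ∧ I x ℓ ∧ I y ℓ}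

/-- The stabilizer `G_u` of a point `u` in a group `G` of automorphisms. -/
def stabPt (G : Subgroup (Perm P × Perm L)) (u : P) : Subgroup (Perm P × Perm L) where
  carrier := {g | g ∈ G ∧ g.1 u = u}
  one_mem' := ⟨G.one_mem, rfl⟩
  mul_mem' := by
    rintro a b ⟨ha, ha'⟩ ⟨hb, hb'⟩
    refine ⟨G.mul_mem ha hb, ?_⟩
    have : (a * b).1 u = a.1 (b.1 u) := rfl
    rw [this, hb', ha']
  inv_mem' := by
    rintro a ⟨ha, ha'⟩
    refine ⟨G.inv_mem ha, ?_⟩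
    have h : a⁻¹.1 (a.1 u) = u := by simp
    rw [ha'] at h
    exact h

/-- The setwise stabilizer `G_ℓ` of a line `ℓ` in a group `G` of automorphisms. -/
def stabLine (G : Subgroup (Perm P × Perm L)) (ℓ : L) : Subgroup (Perm P × Perm L) where
  carrier := {g | g ∈ G ∧ g.2 ℓ = ℓ}
  one_mem' := ⟨G.one_mem, rfl⟩
  mul_mem' := by
    rintro a b ⟨ha, ha'⟩ ⟨hb, hb'⟩
    refine ⟨G.mul_mem ha hb, ?_⟩
    have : (a * b).2 ℓ = a.2 (b.2 ℓ) := rfl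
    rw [this, hb', ha']
  inv_mem' := by
    rintro a ⟨ha, ha'⟩
    refine ⟨G.inv_mem ha, ?_⟩
    have h : a⁻¹.2 (a.2 ℓ) = ℓ := by simp
    rw [ha'] at h
    exact h

/-- Isomorphism of incidence structures: a pair of bijections between the point sets and
the line sets preserving incidence in both directions. -/
def IsoTo {P L P' L' : Type*} (I : P → L → Prop) (I' : P' → L' → Prop) : Prop :=
  ∃ (e : P ≃ P') (f : L ≃ L'), ∀ p ℓ, I' (e p) (f ℓ) ↔ I p ℓ

end GQDefs

section ClassicalGQs

/-- The standard nondegenerate alternating bilinear form on `F^4`. -/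
def sympForm {F : Type*} [Field F] (x y : Fin 4 → F) : F :=
  x 0 * y 1 - x 1 * y 0 + x 2 * y 3 - x 3 * y 2

/-- Points of `W(3,q)`: the `1`-dimensional subspaces of `F_q^4`. -/
def W3Point (F : Type*) [Field F] : Type _ :=
  {W : Submodule F (Fin 4 → F) // Module.finrank F W = 1}

/-- Lines of `W(3,q)`: the `2`-dimensional totally isotropic subspaces of `F_q^4` with
respect to a nondegenerate alternating form. -/
def W3Line (F : Type*) [Field F] : Type _ :=
  {U : Submodule F (Fin 4 → F) //
    Module.finrank F U = 2 ∧ ∀ x ∈ U, ∀ y ∈ U, sympForm x y = 0}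

/-- Incidence in `W(3,q)` is given by inclusion. -/
def W3Incid (F : Type*) [Field F] : W3Point F → W3Line F → Prop :=
  fun W U => W.1 ≤ U.1

/-- The standard nondegenerate Hermitian sesquilinear form on `F_{q²}^4`, relative to the
field automorphism `x ↦ x^q`. -/
def hermForm3 {F : Type*} [Field F] (q : ℕ) (x y : Fin 4 → F) : F :=
  x 0 * y 1 ^ q + x 1 * y 0 ^ q + x 2 * y 3 ^ q + x 3 * y 2 ^ q

/-- The standard nondegenerate Hermitian sesquilinear form on `F_{q²}^5`, relative to the
field automorphism `x ↦ x^q`. -/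
def hermForm4 {F : Type*} [Field F] (q : ℕ) (x y : Fin 5 → F) : F :=
  x 0 * y 1 ^ q + x 1 * y 0 ^ q + x 2 * y 3 ^ q + x 3 * y 2 ^ q + x 4 * y 4 ^ q

/-- Points of `H(3,q²)`: the `1`-dimensional isotropic subspaces of `F_{q²}^4`. -/
def H3Point (F : Type*) [Field F] (q : ℕ) : Type _ :=
  {W : Submodule F (Fin 4 → F) //
    Module.finrank F W = 1 ∧ ∀ x ∈ W, hermForm3 q x x = 0}

/-- Lines of `H(3,q²)`: the `2`-dimensional totally isotropic subspaces of `F_{q²}^4`. -/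
def H3Line (F : Type*) [Field F] (q : ℕ) : Type _ :=
  {U : Submodule F (Fin 4 → F) //
    Module.finrank F U = 2 ∧ ∀ x ∈ U, ∀ y ∈ U, hermForm3 q x y = 0}

/-- Incidence in `H(3,q²)` is given by inclusion. -/
def H3Incid (F : Type*) [Field F] (q : ℕ) : H3Point F q → H3Line F q → Prop :=
  fun W U => W.1 ≤ U.1

/-- Points of `H(4,q²)`: the `1`-dimensional isotropic subspaces of `F_{q²}^5`. -/
def H4Point (F : Type*) [Field F] (q : ℕ) : Type _ :=
  {W : Submodule F (Fin 5 → F) //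
    Module.finrank F W = 1 ∧ ∀ x ∈ W, hermForm4 q x x = 0}

/-- Lines of `H(4,q²)`: the `2`-dimensional totally isotropic subspaces of `F_{q²}^5`. -/
def H4Line (F : Type*) [Field F] (q : ℕ) : Type _ :=
  {U : Submodule F (Fin 5 → F) //
    Module.finrank F U = 2 ∧ ∀ x ∈ U, ∀ y ∈ U, hermForm4 q x y = 0}

/-- Incidence in `H(4,q²)` is given by inclusion. -/
def H4Incid (F : Type*) [Field F] (q : ℕ) : H4Point F q → H4Line F q → Prop :=
  fun W U => W.1 ≤ U.1

end ClassicalGQs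

section CollinearityLemmas

variable {P L : Type*} {I : P → L → Prop} {s t : ℕ}

theorem Coll.symm {x y : P} (h : Coll I x y) : Coll I y x :=
  let ⟨ℓ, hx, hy⟩ := h
  ⟨ℓ, hy, hx⟩

theorem Coll.map {g : Perm P × Perm L} (hg : g ∈ autGroup I) {x y : P} (h : Coll I x y) :
    Coll I (g.1 x) (g.1 y) :=
  let ⟨ℓ, hx, hy⟩ := h
  ⟨g.2 ℓ, (hg x ℓ).2 hx, (hg y ℓ).2 hy⟩

namespace IsGQ

theorem exists_line_ne [Finite L] (h : IsGQ I s t) (ht : 2 ≤ t) (p : P) (ℓ : L) :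
    ∃ m, I p m ∧ m ≠ ℓ := by
  have hcard : ({ℓ} : Set L).ncard < {m : L | I p m}.ncard := by
    have := h.line_count p
    rw [Set.ncard_singleton, ← Nat.card_coe_set_eq]
    change 1 < Nat.card {m : L // I p m}
    omega
  exact Set.exists_mem_notMem_of_ncard_lt_ncard hcard

theorem exists_point_ne_ne [Finite P] (h : IsGQ I s t) (hs : 2 ≤ s) (ℓ : L) (x y : P) :
    ∃ z, I z ℓ ∧ z ≠ x ∧ z ≠ y := by
  have hcard : ({x, y} : Set P).ncard < {z : P | I z ℓ}.ncard := by
    have := h.point_count ℓ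
    refine (Set.ncard_insert_le x {y}).trans_lt ?_
    rw [Set.ncard_singleton, ← Nat.card_coe_set_eq]
    change 1 + 1 < Nat.card {z : P // I z ℓ}
    omega
  obtain ⟨z, hz, hzn⟩ := Set.exists_mem_notMem_of_ncard_lt_ncard hcard
  exact ⟨z, hz, fun e => hzn (by simp [e]), fun e => hzn (by simp [e])⟩

theorem coll_refl (h : IsGQ I s t) (p : P) : Coll I p p := by
  have hpos : 0 < Nat.card {ℓ : L // I p ℓ} := by rw [h.line_count p]; omega
  obtain ⟨⟨ℓ, hℓ⟩⟩ := (Nat.card_pos_iff.1 hpos).1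
  exact ⟨ℓ, hℓ, hℓ⟩

theorem exists_coll_on_line (h : IsGQ I s t) (p : P) (ℓ : L) : ∃ q, I q ℓ ∧ Coll I p q := by
  by_cases hp : I p ℓ
  · exact ⟨p, hp, ℓ, hp, hp⟩
  · obtain ⟨⟨q, M⟩, ⟨h1, h2, h3⟩, -⟩ := h.quad hp
    exact ⟨q, h3, M, h1, h2⟩

/-- There are no triangles: a point off a line is collinear with at most one of its points. -/
theorem eq_of_coll (h : IsGQ I s t) {p q o : P} {ℓ : L} (hp : ¬ I p ℓ) (hq : I q ℓ)
    (ho : I o ℓ) (hpq : Coll I p q) (hpo : Coll I p o) : q = o := by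
  obtain ⟨M, hM, hqM⟩ := hpq
  obtain ⟨M', hM', hoM⟩ := hpo
  exact congrArg Prod.fst
    ((h.quad hp).unique (y₁ := (q, M)) (y₂ := (o, M')) ⟨hM, hqM, hq⟩ ⟨hM', hoM, ho⟩)

/-- A symmetry moves no point to a distinct collinear point. -/
theorem symm_apply_eq_of_coll [Finite L] (h : IsGQ I s t) (ht : 2 ≤ t) {w z : P}
    {g : Perm P × Perm L} (hg : g ∈ symmGroup I w) (hz : Coll I z (g.1 z)) : g.1 z = z := by
  by_cases hwz : Coll I w z
  · exact hg.2 z hwz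
  obtain ⟨N, hzN, hgN⟩ := hz
  obtain ⟨N', hzN', hne⟩ := h.exists_line_ne ht z N
  obtain ⟨q, hqN', hwq⟩ := h.exists_coll_on_line w N'
  have hqz : q ≠ z := fun e => hwz (e ▸ hwq)
  have hqN : ¬ I q N := fun hq => hne (h.unique_line hqz hqN' hzN' hq hzN)
  have hcoll : Coll I q z := ⟨N', hqN', hzN'⟩
  have hcoll' := hcoll.map hg.1
  rw [hg.2 q hwq] at hcoll'
  exact h.eq_of_coll hqN hgN hzN hcoll' hcoll

/-- A line with two points fixed by a symmetry is fixed pointwise. -/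
theorem symm_apply_eq_of_line [Finite L] (h : IsGQ I s t) (ht : 2 ≤ t) {w a b z : P} {ℓ : L}
    {g : Perm P × Perm L} (hg : g ∈ symmGroup I w) (hab : a ≠ b) (ha : g.1 a = a)
    (hb : g.1 b = b) (haℓ : I a ℓ) (hbℓ : I b ℓ) (hzℓ : I z ℓ) : g.1 z = z := by
  have ha' := (hg.1 a ℓ).2 haℓ
  have hb' := (hg.1 b ℓ).2 hbℓ
  rw [ha] at ha'
  rw [hb] at hb'
  have hℓ : g.2 ℓ = ℓ := h.unique_line hab ha' hb' haℓ hbℓ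
  refine h.symm_apply_eq_of_coll ht hg ⟨ℓ, hzℓ, ?_⟩
  have := (hg.1 z ℓ).2 hzℓ
  rwa [hℓ] at this

/-- A symmetry fixing a point not collinear with its center fixes all points collinear with it. -/
theorem symm_apply_eq_of_coll_fixed [Finite L] (h : IsGQ I s t) (ht : 2 ≤ t) {w v z : P}
    {g : Perm P × Perm L} (hg : g ∈ symmGroup I w) (hwv : ¬ Coll I w v) (hv : g.1 v = v)
    (hvz : Coll I v z) : g.1 z = z := by
  obtain ⟨ℓ, hvℓ, hzℓ⟩ := hvz
  obtain ⟨q, hqℓ, hwq⟩ := h.exists_coll_on_line w ℓ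
  have hqv : q ≠ v := fun e => hwv (e ▸ hwq)
  exact h.symm_apply_eq_of_line ht hg hqv (hg.2 q hwq) hv hqℓ hvℓ hzℓ

/-- A symmetry fixing a point not collinear with its center fixes every point. -/
theorem symm_apply_eq_of_fixed [Finite P] [Finite L] (h : IsGQ I s t) (hs : 2 ≤ s) (ht : 2 ≤ t)
    {w v : P} {g : Perm P × Perm L} (hg : g ∈ symmGroup I w) (hwv : ¬ Coll I w v)
    (hv : g.1 v = v) (z : P) : g.1 z = z := by
  have step : ∀ {y c : P}, ¬ Coll I w c → Coll I v c → Coll I c y → g.1 y = y :=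
    fun hwc hvc hcy => h.symm_apply_eq_of_coll_fixed ht hg hwc
      (h.symm_apply_eq_of_coll_fixed ht hg hwv hv hvc) hcy
  by_cases hwz : Coll I w z
  · exact hg.2 z hwz
  by_cases hvz : Coll I v z
  · exact h.symm_apply_eq_of_coll_fixed ht hg hwv hv hvz
  by_cases hall : ∀ c, Coll I v c → Coll I c z → Coll I w c
  swap
  · push Not at hall
    obtain ⟨c, hvc, hcz, hwc⟩ := hall
    exact step hwc hvc hcz
  obtain ⟨N, hzN, -⟩ := h.coll_refl z
  obtain ⟨N', hzN', hNN'⟩ := h.exists_line_ne ht z N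
  obtain ⟨a, haN, hva⟩ := h.exists_coll_on_line v N
  obtain ⟨b, hbN', hvb⟩ := h.exists_coll_on_line v N'
  have hwa := hall a hva ⟨N, haN, hzN⟩
  have hwb := hall b hvb ⟨N', hbN', hzN'⟩
  have hbz : b ≠ z := fun e => hvz (e ▸ hvb)
  have hbN : ¬ I b N := fun hb => hNN' (h.unique_line hbz hbN' hzN' hb hzN)
  obtain ⟨y, hyN, hyz, hya⟩ := h.exists_point_ne_ne hs N z a
  have hwN : ¬ I w N := fun hw => hwz ⟨N, hw, hzN⟩
  have hwy : ¬ Coll I w y := fun hw => hya (h.eq_of_coll hwN hyN haN hw hwa)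
  have hby : ¬ Coll I b y := fun hb =>
    hyz (h.eq_of_coll hbN hyN hzN hb ⟨N', hbN', hzN'⟩)
  obtain ⟨M, hvM, hbM⟩ := hvb
  obtain ⟨c, hcM, hyc⟩ := h.exists_coll_on_line y M
  have hwM : ¬ I w M := fun hw => hwv ⟨M, hw, hvM⟩
  have hwc : ¬ Coll I w c := fun hw =>
    hby (h.eq_of_coll hwM hcM hbM hw hwb ▸ hyc.symm)
  have hy : g.1 y = y := step hwc ⟨M, hvM, hcM⟩ hyc.symm
  exact h.symm_apply_eq_of_coll_fixed ht hg hwy hy ⟨N, hyN, hzN⟩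

/-- An automorphism of a generalized quadrangle fixing every point is trivial. -/
theorem eq_one_of_fixes_points [Finite P] (h : IsGQ I s t) (hs : 2 ≤ s) {g : Perm P × Perm L}
    (hg : g ∈ autGroup I) (hfix : ∀ z, g.1 z = z) : g = 1 := by
  refine Prod.ext (Equiv.ext hfix) (Equiv.ext fun ℓ => ?_)
  have hmap : ∀ z, I z ℓ → I z (g.2 ℓ) := fun z hz => by
    have := (hg z ℓ).2 hz
    rwa [hfix] at this
  have hpos : 0 < Nat.card {z : P // I z ℓ} := by rw [h.point_count ℓ]; omega
  obtain ⟨⟨a, ha⟩⟩ := (Nat.card_pos_iff.1 hpos).1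
  obtain ⟨b, hb, hba, -⟩ := h.exists_point_ne_ne hs ℓ a a
  exact h.unique_line hba (hmap b hb) (hmap a ha) hb ha

/-- A nontrivial symmetry fixes no point that is not collinear with its center. -/
theorem symm_apply_ne [Finite P] [Finite L] (h : IsGQ I s t) (hs : 2 ≤ s) (ht : 2 ≤ t)
    {w v : P} {g : Perm P × Perm L} (hg : g ∈ symmGroup I w) (hne : g ≠ 1)
    (hwv : ¬ Coll I w v) : g.1 v ≠ v := fun hv =>
  hne (h.eq_one_of_fixes_points hs hg.1 (h.symm_apply_eq_of_fixed hs ht hg hwv hv))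

/-- Distinct common neighbours of two noncollinear points are noncollinear. -/
theorem eq_of_coll_of_mem_trace (h : IsGQ I s t) {u u' a b : P} (huu' : ¬ Coll I u u')
    (hua : Coll I u a) (hub : Coll I u b) (hua' : Coll I u' a) (hub' : Coll I u' b)
    (hab : Coll I a b) : a = b := by
  obtain ⟨ℓ, ha, hb⟩ := hab
  by_cases hu : I u ℓ
  · exact h.eq_of_coll (fun hu' => huu' ⟨ℓ, hu, hu'⟩) ha hb hua' hub'
  · exact h.eq_of_coll hu ha hb hua hub

end IsGQ

end CollinearityLemmas

/-- Gleason's lemma: if each point `v` of a finite set `T` is the only fixed point in `T` of some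
element of `H` of prime order `r` preserving `T`, then `H` is transitive on `T`. -/
theorem exists_apply_eq_of_unique_fixedPoint {α G : Type*} [Finite α] [Group G] [MulAction G α]
    (H : Subgroup G) (T : Set α) (r : ℕ) (hr : r.Prime)
    (hT : ∀ v ∈ T, ∃ g ∈ H, g ^ r = 1 ∧ (∀ z ∈ T, g • z ∈ T) ∧
      ∀ z ∈ T, g • z = z ↔ z = v)
    {x y : α} (hx : x ∈ T) (hy : y ∈ T) : ∃ g ∈ H, g • x = y := by
  classical
  have : Fact r.Prime := ⟨hr⟩
  by_contra hxy
  let O : Set α := {z | z ∈ T ∧ ∃ g ∈ H, g • x = z}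
  have : Fintype O := Fintype.ofFinite O
  have key : ∀ v ∈ T, ∃ f : Function.End O, f ^ r ^ 1 = 1 ∧
      ∀ z : O, Function.IsFixedPt f z ↔ (z : α) = v := by
    intro v hv
    obtain ⟨g, hgH, hgr, hgT, hfix⟩ := hT v hv
    let f : Function.End O := fun z => ⟨g • (z : α), hgT _ z.2.1, by
      obtain ⟨k, hk, hkz⟩ := z.2.2
      exact ⟨g * k, H.mul_mem hgH hk, by rw [mul_smul, hkz]⟩⟩
    have hpow : ∀ (n : ℕ) (z : O), ((f ^ n) z : α) = g ^ n • (z : α) := by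
      intro n
      induction n with
      | zero => intro z; rw [pow_zero, pow_zero, one_smul]; rfl
      | succ n ih =>
        intro z
        rw [pow_succ, pow_succ, mul_smul]
        exact ih (f z)
    refine ⟨f, ?_, fun z => ?_⟩
    · funext z
      refine Subtype.ext ?_
      rw [pow_one, hpow, hgr, one_smul]
      rfl
    · exact Subtype.ext_iff.trans (hfix z z.2.1)
  obtain ⟨f, hf, hffix⟩ := key x hx
  obtain ⟨k, hk, hkfix⟩ := key y hy
  have h1 := Equiv.Perm.card_fixedPoints_modEq (p := r) hf
  have h2 := Equiv.Perm.card_fixedPoints_modEq (p := r) hk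
  have hfc : Fintype.card (Function.fixedPoints f) = 1 := by
    rw [Fintype.card_eq_one_iff]
    refine ⟨⟨⟨x, hx, 1, H.one_mem, one_smul _ _⟩, (hffix _).2 rfl⟩, fun z => ?_⟩
    exact Subtype.ext (Subtype.ext ((hffix z.1).1 z.2))
  have hkc : Fintype.card (Function.fixedPoints k) = 0 := by
    rw [Fintype.card_eq_zero_iff]
    refine ⟨fun z => hxy ?_⟩
    obtain ⟨g, hg, hgz⟩ := z.1.2.2
    exact ⟨g, hg, hgz.trans ((hkfix z.1).1 z.2)⟩
  have h01 := h2.symm.trans h1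
  simp only [Fintype.card_eq_nat_card] at h01 hfc hkc
  rw [hfc, hkc] at h01
  exact hr.one_lt.ne' (Nat.dvd_one.1 ((Nat.modEq_zero_iff_dvd).1 h01.symm))

/-- Given nontrivial groups `E(p)` of symmetries with all orders divisible by a prime `r`,
closed under conjugation by `G = ⟨E(p) : p⟩`, the group `I(u^⊥) = ⟨E(w) : w ∈ u^⊥⟩` acts
transitively on `u^⊥ \ {u}` and is a normal subgroup of the stabilizer `G_u`. -/
theorem Iperp_transitive_and_normal {P L : Type} [Finite P] [Finite L]
    (I : P → L → Prop) (s t : ℕ) (hGQ : IsGQ I s t) (hs : 2 ≤ s) (ht : 2 ≤ t)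
    (E : P → Subgroup (Equiv.Perm P × Equiv.Perm L))
    (hEsym : ∀ p : P, E p ≤ symmGroup I p) (hEnt : ∀ p : P, E p ≠ ⊥)
    (r : ℕ) (hr : r.Prime) (hdiv : ∀ p : P, r ∣ Nat.card (E p))
    (hconj : ∀ g ∈ (⨆ p : P, E p : Subgroup (Equiv.Perm P × Equiv.Perm L)), ∀ p : P,
      E (g.1 p) = (E p).map (MulAut.conj g).toMonoidHom)
    (u : P) :
    (∀ x y : P, x ∈ perpSet I u → x ≠ u → y ∈ perpSet I u → y ≠ u →
      ∃ g ∈ (⨆ w ∈ perpSet I u, E w : Subgroup (Equiv.Perm P × Equiv.Perm L)), g.1 x = y) ∧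
    (⨆ w ∈ perpSet I u, E w : Subgroup (Equiv.Perm P × Equiv.Perm L)) ≤
        stabPt (⨆ p : P, E p) u ∧
    ((⨆ w ∈ perpSet I u, E w : Subgroup (Equiv.Perm P × Equiv.Perm L)).subgroupOf
        (stabPt (⨆ p : P, E p) u)).Normal := by
  set H : Subgroup (Equiv.Perm P × Equiv.Perm L) := ⨆ w ∈ perpSet I u, E w
  have hEH : ∀ w, Coll I u w → E w ≤ H := fun w hw => le_iSup₂_of_le w hw le_rfl
  have hEaut : (⨆ p : P, E p) ≤ autGroup I :=
    iSup_le fun p g hg => (hEsym p hg).1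
  have hstab : H ≤ stabPt (⨆ p : P, E p) u :=
    iSup₂_le fun w hw g hg =>
      ⟨Subgroup.mem_iSup_of_mem w hg, (hEsym w hg).2 u (Coll.symm hw)⟩
  have hnoncoll : ∀ x y : P, Coll I u x → Coll I u y → ¬ Coll I x y → ∃ g ∈ H, g.1 x = y := by
    intro x y hux huy hxy
    obtain ⟨ℓ, huℓ, hxℓ⟩ := hux
    obtain ⟨m, hxm, hmℓ⟩ := hGQ.exists_line_ne ht x ℓ
    have hxu : x ≠ u := fun e => hxy (e ▸ huy)
    have hum : ¬ I u m := fun hu => hmℓ (hGQ.unique_line hxu hxm hu hxℓ huℓ)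
    obtain ⟨u', hu'm, hyu'⟩ := hGQ.exists_coll_on_line y m
    have hxu' : x ≠ u' := fun e => hxy (e ▸ hyu'.symm)
    have huu' : ¬ Coll I u u' := fun hc =>
      hxu' (hGQ.eq_of_coll hum hxm hu'm ⟨ℓ, huℓ, hxℓ⟩ hc)
    let _ : MulAction (Equiv.Perm P × Equiv.Perm L) P :=
      MulAction.compHom P (MonoidHom.fst (Equiv.Perm P) (Equiv.Perm L))
    refine exists_apply_eq_of_unique_fixedPoint H {v | Coll I u v ∧ Coll I u' v} r hr ?_
      (⟨⟨ℓ, huℓ, hxℓ⟩, ⟨m, hu'm, hxm⟩⟩ : Coll I u x ∧ Coll I u' x) ⟨huy, hyu'.symm⟩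
    rintro v ⟨huv, hu'v⟩
    have : Fact r.Prime := ⟨hr⟩
    obtain ⟨⟨g, hg⟩, hgr⟩ := exists_prime_orderOf_dvd_card' r (hdiv v)
    rw [Subgroup.orderOf_mk] at hgr
    have hgs := hEsym v hg
    have hg1 : g ≠ 1 := by
      rintro rfl
      exact hr.one_lt.ne (by simpa using hgr)
    refine ⟨g, hEH v huv hg, hgr ▸ pow_orderOf_eq_one g, ?_, ?_⟩
    · rintro z ⟨huz, hu'z⟩
      have h1 := huz.map hgs.1
      have h2 := hu'z.map hgs.1
      rw [hgs.2 _ huv.symm] at h1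
      rw [hgs.2 _ hu'v.symm] at h2
      exact ⟨h1, h2⟩
    · rintro z ⟨huz, hu'z⟩
      refine ⟨fun hz => ?_, ?_⟩
      · by_contra hne
        refine hGQ.symm_apply_ne hs ht hgs hg1 (fun hvz => hne ?_) hz
        exact (hGQ.eq_of_coll_of_mem_trace huu' huv huz hu'v hu'z hvz).symm
      · rintro rfl
        exact hgs.2 z (hGQ.coll_refl z)
  refine ⟨fun x y hx hxu hy hyu => ?_, hstab, ⟨fun n hn g => ?_⟩⟩
  · by_cases hxy : Coll I x y
    · obtain ⟨ℓ, hxℓ, huℓ⟩ := Coll.symm hx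
      obtain ⟨m, hum, hmℓ⟩ := hGQ.exists_line_ne ht u ℓ
      obtain ⟨z, hzm, hzu, -⟩ := hGQ.exists_point_ne_ne hs m u u
      have hyℓ : I y ℓ := by
        by_contra hyℓ
        exact hxu (hGQ.eq_of_coll hyℓ hxℓ huℓ hxy.symm (Coll.symm hy))
      have hzℓ : ¬ I z ℓ := fun hz => hmℓ (hGQ.unique_line hzu hzm hum hz huℓ)
      have huz : Coll I u z := ⟨m, hum, hzm⟩
      have hzx : ¬ Coll I z x := fun hc => hxu (hGQ.eq_of_coll hzℓ hxℓ huℓ hc huz.symm)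
      have hzy : ¬ Coll I z y := fun hc => hyu (hGQ.eq_of_coll hzℓ hyℓ huℓ hc huz.symm)
      obtain ⟨g, hg, hgx⟩ := hnoncoll x z hx huz fun hc => hzx hc.symm
      obtain ⟨k, hk, hkz⟩ := hnoncoll z y huz hy hzy
      exact ⟨k * g, H.mul_mem hk hg, (congrArg k.1 hgx).trans hkz⟩
    · exact hnoncoll x y hx hy hxy
  · obtain ⟨g, hgG, hgu⟩ := g
    rw [Subgroup.mem_subgroupOf] at hn ⊢
    have hle : H ≤ H.comap (MulAut.conj g).toMonoidHom := by
      refine iSup₂_le fun w hw => ?_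
      rw [← Subgroup.map_le_iff_le_comap, ← hconj g hgG w]
      refine hEH _ ?_
      have hc := Coll.map (hEaut hgG) hw
      rwa [hgu] at hc
    exact hle hn
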